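/- The irreducible components of Comp(n) are precisely the subvarieties Comp(n,r) where r ranges over the rank sequences for n that are maximal with respect to the coordinate-wise partial order on rank sequences. -/

import Mathlib

/-!  Circular complexes framework: `K` algebraically closed, char 0;
`n : ZMod l → ℕ` a tuple of positive integers. -/

open MvPolynomial in
/-- The Zariski topology on the affine space `ι → K`: the topology generated by the
basic open sets `{x | p(x) ≠ 0}` for polynomials `p`. -/
def zariskiTopology (ι K : Type) [CommSemiring K] : TopologicalSpace (ι → K) :=
  .generateFrom { U | ∃ p : MvPolynomial ι K, U = { x | eval x p ≠ 0 } }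

/-- The ambient affine space `∏_{i ∈ ℤ/lℤ} Mat_{n_{i+1} × n_i}(K)` in which the
variety of circular complexes lives. -/
abbrev CompSpace (K : Type) [Field K] {l : ℕ} (n : ZMod l → ℕ) : Type :=
  ∀ i : ZMod l, Matrix (Fin (n (i + 1))) (Fin (n i)) K

/-- Coordinates on `CompSpace K n`. -/
def compCoord {K : Type} [Field K] {l : ℕ} (n : ZMod l → ℕ) :
    CompSpace K n → ((Σ i : ZMod l, Fin (n (i + 1)) × Fin (n i)) → K) :=
  fun A q => A q.1 q.2.1 q.2.2

/-- The Zariski topology on `CompSpace K n`, induced from the Zariski topology on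
coordinates. -/
def compTopology (K : Type) [Field K] {l : ℕ} (n : ZMod l → ℕ) :
    TopologicalSpace (CompSpace K n) :=
  (zariskiTopology _ K).induced (compCoord n)

/-- `Comp(𝐧)`, the variety of circular complexes: tuples `(A_i)` with
`A_{i+1} A_i = 0` for all `i ∈ ℤ/lℤ`. -/
def Comp (K : Type) [Field K] {l : ℕ} (n : ZMod l → ℕ) : Set (CompSpace K n) :=
  { A | ∀ i : ZMod l, A (i + 1) * A i = 0 }

/-- `Comp(𝐧,𝐫)`: circular complexes with `rank A_i ≤ r_i` for all `i`. -/
def CompR (K : Type) [Field K] {l : ℕ} (n r : ZMod l → ℕ) : Set (CompSpace K n) :=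
  { A ∈ Comp K n | ∀ i, (A i).rank ≤ r i }

/-- `Comp⁰(𝐧,𝐫)`: circular complexes with `rank A_i = r_i` for all `i`. -/
def Comp0 (K : Type) [Field K] {l : ℕ} (n r : ZMod l → ℕ) : Set (CompSpace K n) :=
  { A ∈ Comp K n | ∀ i, (A i).rank = r i }

/-- `r` is a rank sequence for `n`: it is realized by some circular complex. -/
def IsRankSeq (K : Type) [Field K] {l : ℕ} (n r : ZMod l → ℕ) : Prop :=
  ∃ A ∈ Comp K n, ∀ i, (A i).rank = r i

open MvPolynomial Topology in
theorem isOpen_zariski_basic {ι K : Type} [CommSemiring K] (p : MvPolynomial ι K) :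
    IsOpen[zariskiTopology ι K] {x | eval x p ≠ 0} :=
  TopologicalSpace.isOpen_generateFrom_of_mem ⟨p, rfl⟩

open MvPolynomial in
theorem isTopologicalBasis_zariski (ι K : Type) [CommSemiring K] [NoZeroDivisors K]
    [Nontrivial K] :
    letI := zariskiTopology ι K
    TopologicalSpace.IsTopologicalBasis
      {U : Set (ι → K) | ∃ p : MvPolynomial ι K, U = {x | eval x p ≠ 0}} := by
  let _ := zariskiTopology ι K
  refine TopologicalSpace.isTopologicalBasis_of_subbasis_of_finiteInter rfl ⟨⟨1, ?_⟩, ?_⟩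
  · ext x
    simp
  · rintro _ ⟨p, rfl⟩ _ ⟨q, rfl⟩
    refine ⟨p * q, ?_⟩
    ext x
    simp

open MvPolynomial in
theorem isIrreducible_univ_zariski (ι K : Type) [Field K] [Infinite K] :
    letI := zariskiTopology ι K
    IsIrreducible (Set.univ : Set (ι → K)) := by
  let _ := zariskiTopology ι K
  refine ⟨⟨0, trivial⟩, ?_⟩
  rintro U V hU hV ⟨x, -, hxU⟩ ⟨y, -, hyV⟩
  obtain ⟨_, ⟨p, rfl⟩, hxp, hpU⟩ :=
    (isTopologicalBasis_zariski ι K).exists_subset_of_mem_open hxU hU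
  obtain ⟨_, ⟨q, rfl⟩, hyq, hqV⟩ :=
    (isTopologicalBasis_zariski ι K).exists_subset_of_mem_open hyV hV
  have hpq : p * q ≠ 0 := by
    refine mul_ne_zero ?_ ?_
    · rintro rfl
      simp at hxp
    · rintro rfl
      simp at hyq
  obtain ⟨z, hz⟩ : ∃ z, eval z (p * q) ≠ 0 := by
    by_contra! h
    exact hpq (MvPolynomial.funext fun x => by simpa using h x)
  rw [map_mul] at hz
  exact ⟨z, trivial, hpU (left_ne_zero_of_mul hz), hqV (right_ne_zero_of_mul hz)⟩

open MvPolynomial in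
/-- A map into `CompSpace K n` with polynomial entries is continuous. -/
theorem continuous_compSpace_of_polynomial {σ K : Type} [Field K] {l : ℕ} {n : ZMod l → ℕ}
    (F : ∀ i : ZMod l, Matrix (Fin (n (i + 1))) (Fin (n i)) (MvPolynomial σ K)) :
    @Continuous _ _ (zariskiTopology σ K) (compTopology K n)
      (fun x i => (F i).map (eval x)) := by
  let _ := zariskiTopology σ K
  let _ := zariskiTopology (Σ i : ZMod l, Fin (n (i + 1)) × Fin (n i)) K
  refine continuous_induced_rng.2 (continuous_generateFrom_iff.2 ?_)
  rintro _ ⟨p, rfl⟩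
  convert! isOpen_zariski_basic (bind₁ (fun q => F q.1 q.2.1 q.2.2) p) using 1
  ext x
  have h : eval x (bind₁ (fun q => F q.1 q.2.1 q.2.2) p) =
      eval (compCoord n fun i => (F i).map (eval x)) p := by
    rw [← coe_aeval_eq_eval, ← coe_aeval_eq_eval, RingHom.coe_coe, RingHom.coe_coe, aeval_bind₁]
    rfl
  simp only [Set.mem_preimage, Set.mem_ofPred_eq, Function.comp_apply, h]

/-- A matrix of rank at least `k` has an invertible `k × k` compression. -/
theorem Matrix.le_rank_iff_exists_det_ne_zero {K : Type*} [Field K] {m p k : ℕ}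
    (A : Matrix (Fin m) (Fin p) K) :
    k ≤ A.rank ↔ ∃ (P : Matrix (Fin k) (Fin m) K) (Q : Matrix (Fin p) (Fin k) K),
      (P * A * Q).det ≠ 0 := by
  constructor
  · intro hk
    obtain ⟨v, hv⟩ := exists_linearIndependent_of_le_finrank (R := K)
      (M := LinearMap.range A.mulVecLin) hk
    choose q hq using fun j => (v j).2
    let Q : Matrix (Fin p) (Fin k) K := Matrix.of fun x j => q j x
    have hAQ : LinearIndependent K (A * Q).col := by
      have hcol : (A * Q).col = fun j => (v j : Fin m → K) := by
        funext j
        rw [← hq j]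
        rfl
      rw [hcol]
      exact hv.map' (Submodule.subtype _) (Submodule.ker_subtype _)
    obtain ⟨P, hP⟩ := LinearMap.exists_leftInverse_of_injective (A * Q).mulVecLin
      (LinearMap.ker_eq_bot.2 (Matrix.mulVec_injective_iff.2 hAQ))
    refine ⟨LinearMap.toMatrix' P, Q, ?_⟩
    have : LinearMap.toMatrix' P * (A * Q) = 1 := by
      rw [← LinearMap.toMatrix'_id, ← hP, LinearMap.toMatrix'_comp]
      congr 1
      exact (LinearMap.toMatrix'_toLin' (A * Q)).symm
    rw [Matrix.mul_assoc, this, Matrix.det_one]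
    exact one_ne_zero
  · rintro ⟨P, Q, h⟩
    have h1 := Matrix.rank_of_det_ne_zero h
    rw [Fintype.card_fin] at h1
    calc k = (P * A * Q).rank := h1.symm
      _ ≤ (P * A).rank := Matrix.rank_mul_le_left _ _
      _ ≤ A.rank := Matrix.rank_mul_le_right _ _

open MvPolynomial Topology in
theorem isOpen_le_rank {K : Type} [Field K] {l : ℕ} (n : ZMod l → ℕ) (i : ZMod l) (k : ℕ) :
    IsOpen[compTopology K n] {A : CompSpace K n | k ≤ (A i).rank} := by
  let _ := zariskiTopology (Σ i : ZMod l, Fin (n (i + 1)) × Fin (n i)) K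
  let _ := compTopology K n
  have h : {A : CompSpace K n | k ≤ (A i).rank} =
      ⋃ (P : Matrix (Fin k) (Fin (n (i + 1))) K) (Q : Matrix (Fin (n i)) (Fin k) K),
        {A : CompSpace K n | (P * A i * Q).det ≠ 0} := by
    ext A
    simp [Matrix.le_rank_iff_exists_det_ne_zero]
  rw [h]
  refine isOpen_iUnion fun P => isOpen_iUnion fun Q => ?_
  let S := MvPolynomial (Σ i : ZMod l, Fin (n (i + 1)) × Fin (n i)) K
  let P' : Matrix (Fin k) (Fin (n (i + 1))) S := P.map C
  let Q' : Matrix (Fin (n i)) (Fin k) S := Q.map C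
  let X' : Matrix (Fin (n (i + 1))) (Fin (n i)) S := Matrix.of fun x y => X ⟨i, x, y⟩
  refine isOpen_induced_iff.2 ⟨_, isOpen_zariski_basic (P' * X' * Q').det, ?_⟩
  ext A
  have hX : X'.map (eval (compCoord n A)) = A i := by
    ext x y
    simp [X', compCoord]
  have hP : P'.map (eval (compCoord n A)) = P := by
    ext x y
    simp [P']
  have hQ : Q'.map (eval (compCoord n A)) = Q := by
    ext x y
    simp [Q']
  simp only [Set.mem_preimage, Set.mem_ofPred_eq, RingHom.map_det, RingHom.mapMatrix_apply,
    Matrix.map_mul, hX, hP, hQ]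

/-- A basis of a subspace extends to a basis of the whole space. -/
theorem Module.Basis.exists_extend_of_submodule {K V : Type*} [Field K] [AddCommGroup V]
    [Module K V] [FiniteDimensional K V] (W : Submodule K V) {w m : ℕ}
    (b : Module.Basis (Fin w) K W) (hm : Module.finrank K V = m) :
    ∃ e : Module.Basis (Fin m) K V, ∀ (j : Fin w) (h : (j : ℕ) < m), e ⟨j, h⟩ = b j := by
  obtain ⟨D, hD⟩ := W.exists_isCompl
  have hw : Module.finrank K W = w := by simpa using Module.finrank_eq_card_basis b
  have hsum := Submodule.finrank_add_eq_of_isCompl hD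
  let e' := (b.prod (Module.finBasis K D)).map (Submodule.prodEquivOfIsCompl W D hD)
  refine ⟨e'.reindex (finSumFinEquiv.trans (finCongr (by omega))), fun j h => ?_⟩
  have : (finSumFinEquiv.trans (finCongr (by omega : w + Module.finrank K D = m))).symm ⟨j, h⟩ =
      Sum.inl j := by
    rw [Equiv.symm_apply_eq]
    ext
    simp
  rw [Module.Basis.reindex_apply, this]
  simp [e']

/-- A basis adapted to a two-step flag. -/
theorem Submodule.exists_basis_of_le {K V : Type*} [Field K] [AddCommGroup V]
    [Module K V] [FiniteDimensional K V] {U W : Submodule K V} (hUW : U ≤ W) {m : ℕ}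
    (hm : Module.finrank K V = m) :
    ∃ e : Module.Basis (Fin m) K V,
      (∀ j : Fin m, (j : ℕ) < Module.finrank K W → e j ∈ W) ∧
      (∀ x ∈ U, ∀ j : Fin m, Module.finrank K U ≤ j → e.repr x j = 0) := by
  let bU := (Module.finBasis K U).map (Submodule.comapSubtypeEquivOfLe hUW).symm
  obtain ⟨bW, hbW⟩ := bU.exists_extend_of_submodule (m := Module.finrank K W) _ rfl
  obtain ⟨e, he⟩ := bW.exists_extend_of_submodule (m := m) _ hm
  refine ⟨e, fun j hj => ?_, fun x hx j hj => ?_⟩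
  · rw [he ⟨j, hj⟩ j.2]
    exact (bW _).2
  · have hUW' := Submodule.finrank_mono hUW
    have hWm := hm ▸ Submodule.finrank_le W
    have hx' := congrArg (Submodule.subtype U) ((Module.finBasis K U).sum_repr ⟨x, hx⟩)
    simp only [map_sum, map_smul, Submodule.subtype_apply] at hx'
    rw [← hx', map_sum, Finsupp.finsetSum_apply]
    refine Finset.sum_eq_zero fun k _ => ?_
    have hk : (Module.finBasis K U k : V) = e ⟨k, by omega⟩ := by
      rw [he ⟨k, by omega⟩, hbW k]
      rfl
    rw [hk, map_smul, Module.Basis.repr_self, Finsupp.smul_apply, Finsupp.single_apply,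
      if_neg, smul_zero]
    intro h
    have := congrArg Fin.val h
    simp at this
    omega

/-- The projection onto the first `a` coordinates. -/
def firstProj (R : Type*) [CommRing R] (m a : ℕ) : Matrix (Fin m) (Fin m) R :=
  Matrix.diagonal fun j => if (j : ℕ) < a then 1 else 0

/-- The projection onto the last `b` coordinates. -/
def lastProj (R : Type*) [CommRing R] (m b : ℕ) : Matrix (Fin m) (Fin m) R :=
  Matrix.diagonal fun j => if m - b ≤ (j : ℕ) then 1 else 0

theorem lastProj_mul_firstProj (R : Type*) [CommRing R] {m a b : ℕ} (h : a + b ≤ m) :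
    lastProj R m b * firstProj R m a = 0 := by
  rw [lastProj, firstProj, Matrix.diagonal_mul_diagonal, Matrix.diagonal_eq_zero]
  funext j
  by_cases hj : (j : ℕ) < a
  · have : ¬ m - b ≤ (j : ℕ) := by omega
    simp [this]
  · simp [hj]

theorem firstProj_map {R S : Type*} [CommRing R] [CommRing S] (f : R →+* S) (m a : ℕ) :
    (firstProj R m a).map f = firstProj S m a := by
  rw [firstProj, firstProj, Matrix.diagonal_map (map_zero f)]
  congr 1
  funext j
  simp only [apply_ite f, map_one, map_zero]

theorem lastProj_map {R S : Type*} [CommRing R] [CommRing S] (f : R →+* S) (m b : ℕ) :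
    (lastProj R m b).map f = lastProj S m b := by
  rw [lastProj, lastProj, Matrix.diagonal_map (map_zero f)]
  congr 1
  funext j
  simp only [apply_ite f, map_one, map_zero]

theorem rank_firstProj_le (K : Type*) [Field K] (m a : ℕ) : (firstProj K m a).rank ≤ a := by
  classical
  rw [firstProj, Matrix.rank_diagonal]
  refine (Fintype.card_le_of_injective
    (fun j : {j : Fin m // (if (j : ℕ) < a then (1 : K) else 0) ≠ 0} => (⟨j, ?_⟩ : Fin a))
    ?_).trans_eq (Fintype.card_fin a)
  · by_contra h
    exact j.2 (if_neg h)
  · intro x y h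
    exact Subtype.ext (Fin.ext (by simpa using h))

open Matrix in
/-- For `B * A = 0`, a change of coordinates moving the range of `A` into the first coordinates
and making `B` depend only on the last ones. -/
theorem Matrix.exists_adapted_coordinates {K : Type*} [Field K] {m p q : ℕ}
    (A : Matrix (Fin m) (Fin p) K) (B : Matrix (Fin q) (Fin m) K) (hBA : B * A = 0) {a b : ℕ}
    (ha : A.rank ≤ a) (hb : B.rank ≤ b) :
    ∃ g : Matrix (Fin m) (Fin m) K, g.det ≠ 0 ∧
      firstProj K m a * (g⁻¹ * A) = g⁻¹ * A ∧ B * g * lastProj K m b = B * g := by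
  have hle : LinearMap.range A.mulVecLin ≤ LinearMap.ker B.mulVecLin := by
    rw [LinearMap.range_le_ker_iff, ← Matrix.mulVecLin_mul, hBA, Matrix.mulVecLin_zero]
  obtain ⟨e, heW, heU⟩ := Submodule.exists_basis_of_le hle (Module.finrank_fin_fun K)
  have hker := B.mulVecLin.finrank_range_add_finrank_ker
  rw [Module.finrank_fin_fun] at hker
  change B.rank + _ = m at hker
  let g := (Pi.basisFun K (Fin m)).toMatrix e
  have hgh : g * e.toMatrix (Pi.basisFun K (Fin m)) = 1 :=
    Module.Basis.toMatrix_mul_toMatrix_flip _ _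
  have hginv : g⁻¹ = e.toMatrix (Pi.basisFun K (Fin m)) := Matrix.inv_eq_right_inv hgh
  refine ⟨g, (Matrix.isUnit_det_of_right_inverse hgh).ne_zero, ?_, ?_⟩
  · ext x y
    rw [firstProj, Matrix.diagonal_mul]
    split_ifs with hx
    · rw [one_mul]
    · rw [zero_mul]
      have h1 : (g⁻¹ * A) x y = e.repr (A.col y) x := by
        rw [hginv]
        exact congrFun (Module.Basis.toMatrix_mulVec_repr (Pi.basisFun K (Fin m)) e (A.col y)) x
      rw [h1, heU _ ⟨Pi.single y 1, by simp⟩ x]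
      change A.rank ≤ _
      omega
  · ext x y
    rw [lastProj, Matrix.mul_diagonal]
    split_ifs with hy
    · rw [mul_one]
    · rw [mul_zero]
      have h1 : (B * g) x y = (B *ᵥ e y) x := rfl
      have h2 : B *ᵥ e y = 0 := heW y (by omega)
      rw [h1, h2]
      rfl

/-- A polynomial parametrization of the circular complexes with ranks bounded by `r`. -/
def circularParam {R : Type*} [CommRing R] {l : ℕ} (n r : ZMod l → ℕ)
    (g : ∀ i, Matrix (Fin (n i)) (Fin (n i)) R)
    (D : ∀ i : ZMod l, Matrix (Fin (n (i + 1))) (Fin (n i)) R) (i : ZMod l) :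
    Matrix (Fin (n (i + 1))) (Fin (n i)) R :=
  g (i + 1) * firstProj R (n (i + 1)) (r i) * D i * lastProj R (n i) (r i) * (g i).adjugate

theorem circularParam_map {R S : Type*} [CommRing R] [CommRing S] (f : R →+* S) {l : ℕ}
    (n r : ZMod l → ℕ) (g : ∀ i, Matrix (Fin (n i)) (Fin (n i)) R)
    (D : ∀ i : ZMod l, Matrix (Fin (n (i + 1))) (Fin (n i)) R) (i : ZMod l) :
    (circularParam n r g D i).map f =
      circularParam n r (fun i => (g i).map f) (fun i => (D i).map f) i := by
  have h := f.map_adjugate (g i)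
  simp only [RingHom.mapMatrix_apply] at h
  simp only [circularParam, Matrix.map_mul, firstProj_map, lastProj_map, h]

theorem circularParam_mem_compR {K : Type} [Field K] {l : ℕ} {n r : ZMod l → ℕ}
    (hr : ∀ i, r i + r (i + 1) ≤ n (i + 1)) (g : ∀ i, Matrix (Fin (n i)) (Fin (n i)) K)
    (D : CompSpace K n) : circularParam n r g D ∈ CompR K n r := by
  refine ⟨fun i => ?_, fun i => ?_⟩
  · have h : circularParam n r g D (i + 1) * circularParam n r g D i =
        g (i + 1 + 1) * firstProj K (n (i + 1 + 1)) (r (i + 1)) * D (i + 1) *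
          (lastProj K (n (i + 1)) (r (i + 1)) * ((g (i + 1)).adjugate * g (i + 1)) *
            firstProj K (n (i + 1)) (r i)) * D i * lastProj K (n i) (r i) * (g i).adjugate := by
      simp only [circularParam, Matrix.mul_assoc]
    rw [h, Matrix.adjugate_mul, Matrix.mul_smul, Matrix.mul_one, Matrix.smul_mul,
      lastProj_mul_firstProj K (hr i)]
    simp
  · calc (circularParam n r g D i).rank
        ≤ (g (i + 1) * firstProj K (n (i + 1)) (r i) * D i * lastProj K (n i) (r i)).rank :=
          Matrix.rank_mul_le_left _ _
      _ ≤ (g (i + 1) * firstProj K (n (i + 1)) (r i) * D i).rank := Matrix.rank_mul_le_left _ _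
      _ ≤ (g (i + 1) * firstProj K (n (i + 1)) (r i)).rank := Matrix.rank_mul_le_left _ _
      _ ≤ (firstProj K (n (i + 1)) (r i)).rank := Matrix.rank_mul_le_right _ _
      _ ≤ r i := rank_firstProj_le K _ _

theorem exists_circularParam_eq {K : Type} [Field K] {l : ℕ} {n r : ZMod l → ℕ}
    {A : CompSpace K n} (hA : A ∈ CompR K n r) : ∃ g D, circularParam n r g D = A := by
  choose g' hg' using fun i =>
    Matrix.exists_adapted_coordinates (A i) (A (i + 1)) (hA.1 i) (hA.2 i) (hA.2 (i + 1))
  obtain ⟨g, hg⟩ : ∃ g : ∀ i, Matrix (Fin (n i)) (Fin (n i)) K, ∀ i, g (i + 1) = g' i :=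
    ⟨Equiv.piCongrLeft (fun i => Matrix (Fin (n i)) (Fin (n i)) K) (Equiv.addRight 1) g',
      Equiv.piCongrLeft_apply_apply (fun i => Matrix (Fin (n i)) (Fin (n i)) K)
        (Equiv.addRight (1 : ZMod l)) g'⟩
  simp only [← hg] at hg'
  have hlast : ∀ i, A i * g i * lastProj K (n i) (r i) = A i * g i := by
    intro i
    obtain ⟨i, rfl⟩ := (Equiv.addRight (1 : ZMod l)).surjective i
    exact (hg' i).2.2
  have hdet : ∀ i, (g i).det ≠ 0 := by
    intro i
    obtain ⟨i, rfl⟩ := (Equiv.addRight (1 : ZMod l)).surjective i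
    exact (hg' i).1
  refine ⟨g, fun i => (g i).det⁻¹ • ((g (i + 1))⁻¹ * A i * g i), ?_⟩
  funext i
  calc circularParam n r g (fun i => (g i).det⁻¹ • ((g (i + 1))⁻¹ * A i * g i)) i
      = (g i).det⁻¹ • (g (i + 1) * ((firstProj K (n (i + 1)) (r i) * ((g (i + 1))⁻¹ * A i)) * g i *
          lastProj K (n i) (r i)) * (g i).adjugate) := by
        simp only [circularParam, Matrix.mul_smul, Matrix.smul_mul, Matrix.mul_assoc]
    _ = (g i).det⁻¹ • (g (i + 1) * (g (i + 1))⁻¹ * (A i * g i * lastProj K (n i) (r i)) *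
          (g i).adjugate) := by
        rw [(hg' i).2.1]
        simp only [Matrix.mul_assoc]
    _ = (g i).det⁻¹ • (A i * (g i * (g i).adjugate)) := by
        rw [hlast, Matrix.mul_nonsing_inv _ (hdet (i + 1)).isUnit, Matrix.one_mul,
          Matrix.mul_assoc]
    _ = A i := by
        rw [Matrix.mul_adjugate, Matrix.mul_smul, Matrix.mul_one, smul_smul,
          inv_mul_cancel₀ (hdet i), one_smul]

theorem IsRankSeq.add_le {K : Type} [Field K] {l : ℕ} {n r : ZMod l → ℕ}
    (hr : IsRankSeq K n r) (i : ZMod l) : r i + r (i + 1) ≤ n (i + 1) := by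
  obtain ⟨A, hA, hAr⟩ := hr
  have h := Matrix.rank_add_rank_le_card_of_mul_eq_zero (hA i)
  rw [hAr, hAr, Fintype.card_fin] at h
  omega

open MvPolynomial in
theorem isIrreducible_compR {K : Type} [Field K] [Infinite K] {l : ℕ} {n r : ZMod l → ℕ}
    (hr : ∀ i, r i + r (i + 1) ≤ n (i + 1)) :
    letI := compTopology K n
    IsIrreducible (CompR K n r) := by
  let σ := (Σ i : ZMod l, Fin (n i) × Fin (n i)) ⊕ (Σ i : ZMod l, Fin (n (i + 1)) × Fin (n i))
  let _ := compTopology K n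
  let _ := zariskiTopology σ K
  let G : ∀ i, Matrix (Fin (n i)) (Fin (n i)) (MvPolynomial σ K) :=
    fun i => Matrix.of fun x y => X (.inl ⟨i, x, y⟩)
  let E : ∀ i : ZMod l, Matrix (Fin (n (i + 1))) (Fin (n i)) (MvPolynomial σ K) :=
    fun i => Matrix.of fun x y => X (.inr ⟨i, x, y⟩)
  have himage : (fun (x : σ → K) i => (circularParam n r G E i).map (eval x)) '' Set.univ =
      CompR K n r := by
    ext A
    simp only [circularParam_map, Set.image_univ, Set.mem_range]
    constructor
    · rintro ⟨x, rfl⟩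
      exact circularParam_mem_compR hr _ _
    · intro hA
      obtain ⟨g, D, rfl⟩ := exists_circularParam_eq hA
      refine ⟨Sum.elim (fun q => g q.1 q.2.1 q.2.2) (fun q => D q.1 q.2.1 q.2.2), ?_⟩
      funext i
      congr 1
      · funext j
        ext x y
        simp [G]
      · funext j
        ext x y
        simp [E]
  rw [← himage]
  exact (isIrreducible_univ_zariski σ K).image _
    (continuous_compSpace_of_polynomial _).continuousOn

/-- An irreducible set of circular complexes contains one attaining all maximal ranks. -/
theorem exists_isRankSeq_subset_compR {K : Type} [Field K] {l : ℕ} [NeZero l] {n : ZMod l → ℕ}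
    {T : Set (CompSpace K n)} (hT : T ⊆ Comp K n)
    (hirr : letI := compTopology K n; IsIrreducible T) :
    ∃ r, IsRankSeq K n r ∧ T ⊆ CompR K n r := by
  let _ := compTopology K n
  have hmax : ∀ i, ∃ A ∈ T, ∀ B ∈ T, (B i).rank ≤ (A i).rank := by
    intro i
    obtain ⟨_, ⟨A, hA, rfl⟩, hAmax⟩ :=
      Set.exists_max_image ((fun A : CompSpace K n => (A i).rank) '' T) id
      ((Set.finite_Iic (n i)).subset (by
        rintro _ ⟨A, -, rfl⟩
        exact Matrix.rank_le_width (A i))) (hirr.nonempty.image _)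
    exact ⟨A, hA, fun B hB => hAmax _ ⟨B, hB, rfl⟩⟩
  choose A hA hAmax using hmax
  classical
  let U : ZMod l → Set (CompSpace K n) := fun i => {B | (A i i).rank ≤ (B i).rank}
  obtain ⟨B, hBT, hB⟩ := isIrreducible_iff_sInter.1 hirr (Finset.univ.image U)
    (by
      simp only [Finset.mem_image, Finset.mem_univ, true_and]
      rintro _ ⟨i, rfl⟩
      exact isOpen_le_rank n i _)
    (by
      simp only [Finset.mem_image, Finset.mem_univ, true_and]
      rintro _ ⟨i, rfl⟩
      exact ⟨A i, hA i, le_refl (A i i).rank⟩)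
  refine ⟨fun i => (A i i).rank, ⟨B, hT hBT, fun i => ?_⟩,
    fun C hC => ⟨hT hC, fun i => hAmax i C hC⟩⟩
  have hBi : B ∈ U i := hB _ (by simp)
  exact (hAmax i B hBT).antisymm hBi

theorem compR_mono {K : Type} [Field K] {l : ℕ} {n r s : ZMod l → ℕ} (h : ∀ i, r i ≤ s i) :
    CompR K n r ⊆ CompR K n s :=
  fun _ hA => ⟨hA.1, fun i => (hA.2 i).trans (h i)⟩

theorem IsRankSeq.le_of_compR_subset {K : Type} [Field K] {l : ℕ} {n r s : ZMod l → ℕ}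
    (hr : IsRankSeq K n r) (h : CompR K n r ⊆ CompR K n s) (i : ZMod l) : r i ≤ s i := by
  obtain ⟨A, hA, hAr⟩ := hr
  exact hAr i ▸ (h ⟨hA, fun i => (hAr i).le⟩).2 i

/-- **Statement 3.** The irreducible components of `Comp(n)` (i.e. the maximal
irreducible subsets of `Comp(n)`) are precisely the subvarieties `Comp(n,r)` with `r` a
maximal rank sequence for `n` with respect to the coordinate-wise order. -/
theorem irreducibleComponents_Comp {K : Type} [Field K] [IsAlgClosed K] [CharZero K]
    {l : ℕ} [NeZero l] (n : ZMod l → ℕ) (hn : ∀ i, 0 < n i) (T : Set (CompSpace K n)) :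
    letI := compTopology K n
    (T ⊆ Comp K n ∧ IsIrreducible T ∧
        ∀ T' : Set (CompSpace K n), T' ⊆ Comp K n → IsIrreducible T' → T ⊆ T' → T' = T) ↔
      (∃ r : ZMod l → ℕ, IsRankSeq K n r ∧
        (∀ r' : ZMod l → ℕ, IsRankSeq K n r' → (∀ i, r i ≤ r' i) → r' = r) ∧
        T = CompR K n r) := by
  let _ := compTopology K n
  have : Infinite K := IsAlgClosed.instInfinite
  constructor
  · rintro ⟨hT, hirr, hmax⟩
    obtain ⟨r, hr, hTr⟩ := exists_isRankSeq_subset_compR hT hirr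
    have hTeq : CompR K n r = T := hmax _ (fun _ h => h.1) (isIrreducible_compR hr.add_le) hTr
    refine ⟨r, hr, fun r' hr' hle => ?_, hTeq.symm⟩
    have h : CompR K n r' = T :=
      hmax _ (fun _ h => h.1) (isIrreducible_compR hr'.add_le) (hTr.trans (compR_mono hle))
    funext i
    exact (hr'.le_of_compR_subset (h.trans hTeq.symm).subset i).antisymm (hle i)
  · rintro ⟨r, hr, hmax, rfl⟩
    refine ⟨fun _ h => h.1, isIrreducible_compR hr.add_le, fun T' hT' hirr hle => ?_⟩
    obtain ⟨s, hs, hTs⟩ := exists_isRankSeq_subset_compR hT' hirr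
    obtain rfl := hmax s hs (hr.le_of_compR_subset (hle.trans hTs))
    exact hTs.antisymm hle
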